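/- arXiv:2504.12603 — 2 statements merged into one kernel-verified Lean document; each statement's English description precedes it below -/
import Mathlib

section
/- Assume cov(𝒩) = 𝔠. Then there exists a Mazurkiewicz set M ⊆ ℝ × ℝ such that for every θ ∈ ℝ, the rotated set ρ_θ(M) is both a Mazurkiewicz set and a Sierpiński–Zygmund set. -/
open Cardinal Set

noncomputable section

/-- The line through `p` with direction `v`. -/
def lineThrough (p v : ℝ × ℝ) : Set (ℝ × ℝ) := {q | ∃ t : ℝ, q = p + t • v}

/-- `L` is a straight line of `ℝ²`. -/
def IsLine (L : Set (ℝ × ℝ)) : Prop := ∃ p v : ℝ × ℝ, v ≠ 0 ∧ L = lineThrough p v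

/-- `L` is a vertical line of `ℝ²`. -/
def IsVerticalLine (L : Set (ℝ × ℝ)) : Prop := ∃ x : ℝ, L = {p : ℝ × ℝ | p.1 = x}

/-- `L₁` and `L₂` are parallel lines. -/
def ParallelLines (L₁ L₂ : Set (ℝ × ℝ)) : Prop :=
  ∃ (p₁ p₂ v : ℝ × ℝ) (c : ℝ), v ≠ 0 ∧ c ≠ 0 ∧
    L₁ = lineThrough p₁ v ∧ L₂ = lineThrough p₂ (c • v)

/-- A Mazurkiewicz set meets every line in exactly two points. -/
def IsMazurkiewicz (M : Set (ℝ × ℝ)) : Prop :=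
  ∀ L : Set (ℝ × ℝ), IsLine L → (M ∩ L).encard = 2

/-- The graph of a partial function `g` defined on `S ⊆ ℝ`. -/
def graphOn (S : Set ℝ) (g : S → ℝ) : Set (ℝ × ℝ) := {p | ∃ x : S, p = ((x : ℝ), g x)}

/-- The graph of a function `f : ℝ → ℝ`. -/
def graphOf (f : ℝ → ℝ) : Set (ℝ × ℝ) := {p | ∃ x : ℝ, p = (x, f x)}

/-- A Sierpiński–Zygmund set. -/
def IsSZSet (X : Set (ℝ × ℝ)) : Prop :=
  ∀ (S : Set ℝ) (g : S → ℝ), Continuous g →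
    #↥(X ∩ graphOn S g) < Cardinal.continuum

/-- A Sierpiński–Zygmund function. -/
def IsSZFun (f : ℝ → ℝ) : Prop :=
  ∀ (S : Set ℝ) (g : S → ℝ), Continuous g →
    #↥{x : S | f x.1 = g x} < Cardinal.continuum

/-- Rotation about the origin by angle `θ`. -/
def rot (θ : ℝ) (p : ℝ × ℝ) : ℝ × ℝ :=
  (p.1 * Real.cos θ - p.2 * Real.sin θ, p.1 * Real.sin θ + p.2 * Real.cos θ)

/-- A Hamel basis of `ℝ²`: a basis of `ℝ × ℝ` as a vector space over `ℚ`. -/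
def IsHamelBasis (H : Set (ℝ × ℝ)) : Prop :=
  LinearIndependent ℚ ((↑) : H → ℝ × ℝ) ∧ Submodule.span ℚ H = ⊤

/-- A Hamel function: a function whose graph is a Hamel basis of `ℝ²`. -/
def IsHamelFun (h : ℝ → ℝ) : Prop := IsHamelBasis (graphOf h)

/-- `cov(𝒩) = 𝔠`: no union of fewer than `𝔠`-many Lebesgue-null subsets of `ℝ`
covers `ℝ`. -/
def CovNullEqContinuum : Prop :=
  ∀ (I : Type) (A : I → Set ℝ), #I < Cardinal.continuum →
    (∀ i : I, MeasureTheory.volume (A i) = 0) → (⋃ i : I, A i) ≠ Set.univ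

open MeasureTheory

/-! ### Lines and rotations -/

lemma lineThrough_eq_of_mem {p v x y : ℝ × ℝ} (hx : x ∈ lineThrough p v)
    (hy : y ∈ lineThrough p v) (hxy : x ≠ y) : lineThrough p v = lineThrough x (y - x) := by
  obtain ⟨s, rfl⟩ := hx
  obtain ⟨t, rfl⟩ := hy
  have hst : t - s ≠ 0 := by
    intro h
    exact hxy (by rw [sub_eq_zero.1 h])
  ext q
  constructor
  · rintro ⟨r, rfl⟩
    refine ⟨(r - s) / (t - s), ?_⟩
    have h : (r - s) / (t - s) * (t - s) = r - s := div_mul_cancel₀ _ hst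
    have e : p + t • v - (p + s • v) = (t - s) • v := by module
    rw [e, smul_smul, h]
    module
  · rintro ⟨r, rfl⟩
    exact ⟨s + r * (t - s), by module⟩

lemma IsLine.eq_lineThrough {L : Set (ℝ × ℝ)} (hL : IsLine L) {x y : ℝ × ℝ} (hx : x ∈ L)
    (hy : y ∈ L) (hxy : x ≠ y) : L = lineThrough x (y - x) := by
  obtain ⟨p, v, -, rfl⟩ := hL
  exact lineThrough_eq_of_mem hx hy hxy

lemma isClosed_lineThrough (p v : ℝ × ℝ) : IsClosed (lineThrough p v) := by
  by_cases hv : v = 0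
  · have : lineThrough p v = {p} := by
      ext q
      simp [lineThrough, hv]
    rw [this]
    exact isClosed_singleton
  · have : lineThrough p v = {q | (q.1 - p.1) * v.2 = (q.2 - p.2) * v.1} := by
      ext q
      constructor
      · rintro ⟨t, rfl⟩
        simp only [mem_ofPred_eq, Prod.fst_add, Prod.snd_add, Prod.smul_fst, Prod.smul_snd,
          smul_eq_mul]
        ring
      · intro h
        simp only [mem_ofPred_eq] at h
        by_cases h1 : v.1 = 0
        · have h2 : v.2 ≠ 0 := fun h2 => hv (Prod.ext h1 h2)
          have h3 : q.1 - p.1 = 0 := by simpa [h1, h2] using h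
          refine ⟨(q.2 - p.2) / v.2, Prod.ext ?_ ?_⟩
          · simp [h1]
            linarith
          · simp [h2]
        · refine ⟨(q.1 - p.1) / v.1, Prod.ext ?_ ?_⟩
          · simp [h1]
          · simp only [Prod.snd_add, Prod.smul_snd, smul_eq_mul]
            field_simp
            linarith
    rw [this]
    exact isClosed_eq (by fun_prop) (by fun_prop)

lemma rot_neg_rot (θ : ℝ) (p : ℝ × ℝ) : rot (-θ) (rot θ p) = p := by
  have h := Real.sin_sq_add_cos_sq θ
  ext <;> simp only [rot, Real.cos_neg, Real.sin_neg]
  · linear_combination p.1 * h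
  · linear_combination p.2 * h

lemma rot_rot_neg (θ : ℝ) (p : ℝ × ℝ) : rot θ (rot (-θ) p) = p := by
  simpa using rot_neg_rot (-θ) p

lemma rot_add_smul (θ t : ℝ) (p v : ℝ × ℝ) : rot θ (p + t • v) = rot θ p + t • rot θ v := by
  ext <;> simp [rot] <;> ring

lemma IsLine.preimage_rot {L : Set (ℝ × ℝ)} (hL : IsLine L) (θ : ℝ) : IsLine (rot θ ⁻¹' L) := by
  obtain ⟨p, v, hv, rfl⟩ := hL
  refine ⟨rot (-θ) p, rot (-θ) v, fun h => hv ?_, ?_⟩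
  · rw [← rot_rot_neg θ v, h]
    simp [rot]
  · ext q
    refine exists_congr fun t => ?_
    rw [← rot_add_smul]
    constructor
    · intro h
      rw [← h, rot_neg_rot]
    · rintro rfl
      rw [rot_rot_neg]

lemma IsMazurkiewicz.image_rot {M : Set (ℝ × ℝ)} (hM : IsMazurkiewicz M) (θ : ℝ) :
    IsMazurkiewicz (rot θ '' M) := by
  intro L hL
  rw [← image_inter_preimage,
    (Function.LeftInverse.injective (rot_neg_rot θ)).injOn.encard_image]
  exact hM _ (hL.preimage_rot θ)

/-! ### Lines meeting a Borel graph in a set of positive length -/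

/-- The line through `p` with direction `v` meets `F` in a set of length zero. -/
def NullOnLine (F : Set (ℝ × ℝ)) (p v : ℝ × ℝ) : Prop :=
  volume {t : ℝ | p + t • v ∈ F} = 0

lemma volume_image_pos_of_not_nullOnLine {F : Set (ℝ × ℝ)} (π : ℝ × ℝ →ₗ[ℝ] ℝ)
    (hπ : InjOn π F) {p v : ℝ × ℝ} (hv : v ≠ 0) (h : ¬ NullOnLine F p v) :
    0 < volume (π '' (F ∩ lineThrough p v)) := by
  have hb : π v ≠ 0 := by
    intro hb
    refine h (Subsingleton.measure_zero (fun s hs t ht => ?_) _)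
    have := hπ hs ht (by simp [hb])
    exact smul_left_injective ℝ hv (add_left_cancel this)
  refine pos_iff_ne_zero.2 fun h0 => h (measure_mono_null (t := (fun t => t * π v) ⁻¹'
    ((fun s => π p + s) ⁻¹' (π '' (F ∩ lineThrough p v)))) ?_ ?_)
  · intro t ht
    exact ⟨p + t • v, ⟨ht, t, rfl⟩, by simp⟩
  · rw [Real.volume_preimage_mul_right hb, measure_preimage_add, h0, mul_zero]

lemma countable_not_nullOnLine {F : Set (ℝ × ℝ)} (hF : MeasurableSet F) (π : ℝ × ℝ →ₗ[ℝ] ℝ)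
    (hπ : InjOn π F) :
    {L | ∃ p v, v ≠ 0 ∧ L = lineThrough p v ∧ ¬ NullOnLine F p v}.Countable := by
  set B := {L | ∃ p v, v ≠ 0 ∧ L = lineThrough p v ∧ ¬ NullOnLine F p v}
  have hcont : Continuous π := π.continuous_of_finiteDimensional
  have key : Set.Countable {L : B | 0 < volume (π '' (F ∩ L))} := by
    refine Measure.countable_meas_pos_of_disjoint_iUnion₀ (fun L => ?_) ?_
    · obtain ⟨L, p, v, -, rfl, -⟩ := L
      exact ((hF.inter (isClosed_lineThrough p v).measurableSet).image_of_measurable_injOn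
        hcont.measurable (hπ.mono inter_subset_left)).nullMeasurableSet
    · rintro ⟨L, p, v, hv, hL, _⟩ ⟨L', p', v', hv', hL', _⟩ hne
      refine Subsingleton.measure_zero ?_ _
      rintro _ ⟨⟨x, hx, rfl⟩, ⟨x', hx', hxx'⟩⟩ _ ⟨⟨y, hy, rfl⟩, ⟨y', hy', hyy'⟩⟩
      obtain rfl := hπ hx'.1 hx.1 hxx'
      obtain rfl := hπ hy'.1 hy.1 hyy'
      by_contra hxy
      have hxy : x' ≠ y' := fun h => hxy (by rw [h])
      refine hne (Subtype.ext ?_)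
      have h1 := IsLine.eq_lineThrough ⟨p, v, hv, hL⟩ hx.2 hy.2 hxy
      have h2 := IsLine.eq_lineThrough ⟨p', v', hv', hL'⟩ hx'.2 hy'.2 hxy
      exact h1.trans h2.symm
  have huniv : {L : B | 0 < volume (π '' (F ∩ L))} = Set.univ := by
    refine eq_univ_of_forall ?_
    rintro ⟨L, p, v, hv, rfl, h⟩
    exact volume_image_pos_of_not_nullOnLine π hπ hv h
  rw [huniv, countable_univ_iff] at key
  exact key

/-! ### Borel graphs coded by sequences of points -/

/-- The points `p` above an accumulation point `p.1` of the abscissas of `d` at which the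
ordinates of `d` converge to `p.2`. -/
def limitGraph (d : ℕ → ℝ × ℝ) : Set (ℝ × ℝ) :=
  {p | (∀ k : ℕ, ∃ m : ℕ, ∀ n, |(d n).1 - p.1| < 1 / (m + 1 : ℝ) →
      |(d n).2 - p.2| ≤ 1 / (k + 1 : ℝ)) ∧
    ∀ m : ℕ, ∃ n, |(d n).1 - p.1| < 1 / (m + 1 : ℝ)}

lemma measurableSet_limitGraph (d : ℕ → ℝ × ℝ) : MeasurableSet (limitGraph d) := by
  have h1 (n m : ℕ) : MeasurableSet {p : ℝ × ℝ | |(d n).1 - p.1| < 1 / (m + 1 : ℝ)} :=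
    measurableSet_lt (by fun_prop) measurable_const
  have h2 (n k : ℕ) : MeasurableSet {p : ℝ × ℝ | |(d n).2 - p.2| ≤ 1 / (k + 1 : ℝ)} :=
    measurableSet_le (by fun_prop) measurable_const
  simp only [limitGraph, imp_iff_not_or, ofPred_and, ofPred_forall, ofPred_exists, ofPred_or]
  exact (MeasurableSet.iInter fun k => .iUnion fun m => .iInter fun n =>
    (h1 n m).compl.union (h2 n k)).inter (.iInter fun m => .iUnion fun n => h1 n m)

lemma injOn_fst_limitGraph (d : ℕ → ℝ × ℝ) : InjOn Prod.fst (limitGraph d) := by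
  rintro ⟨x, y⟩ hp ⟨x', y'⟩ hq (rfl : x = x')
  refine Prod.ext rfl (eq_of_forall_dist_le fun ε hε => ?_)
  obtain ⟨k, hk⟩ := exists_nat_one_div_lt (half_pos hε)
  obtain ⟨m, hm⟩ := hp.1 k
  obtain ⟨m', hm'⟩ := hq.1 k
  obtain ⟨n, hn⟩ := hp.2 (max m m')
  have hle (j : ℕ) (hj : j ≤ max m m') : |(d n).1 - x| < 1 / (j + 1 : ℝ) :=
    hn.trans_le (one_div_le_one_div_of_le (by positivity) (by gcongr))
  have h := abs_le.1 (hm n (hle m (le_max_left _ _)))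
  have h' := abs_le.1 (hm' n (hle m' (le_max_right _ _)))
  simp only at h h'
  rw [Real.dist_eq, abs_le]
  constructor <;> linarith [h.1, h.2, h'.1, h'.2]

lemma exists_graphOn_subset_limitGraph (S : Set ℝ) (g : S → ℝ) (hg : Continuous g)
    (hS : S.Nonempty) : ∃ d, graphOn S g ⊆ limitGraph d := by
  have : Nonempty S := hS.to_subtype
  refine ⟨fun n => ((TopologicalSpace.denseSeq S n : ℝ), g (TopologicalSpace.denseSeq S n)), ?_⟩
  rintro _ ⟨x, rfl⟩
  constructor
  · intro k
    obtain ⟨δ, hδ, h⟩ := Metric.continuous_iff.1 hg x (1 / (k + 1 : ℝ)) (by positivity)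
    obtain ⟨m, hm⟩ := exists_nat_one_div_lt hδ
    exact ⟨m, fun n hn => (h _ (lt_trans hn hm)).le⟩
  · intro m
    obtain ⟨n, hn⟩ := (TopologicalSpace.denseRange_denseSeq S).exists_dist_lt x
      (ε := 1 / (m + 1 : ℝ)) (by positivity)
    exact ⟨n, by rwa [dist_comm] at hn⟩

/-! ### The transfinite construction -/

section Construction

variable {W : Type} [LinearOrder W] [WellFoundedLT W]

/-- The points of the line through `l.1` with direction `l.2` that may be added at stage `a`,
when `old b` has been added at stage `b < a`. For `x = y` the second condition says `q ≠ x`. -/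
def admissible (l : (ℝ × ℝ) × (ℝ × ℝ)) (F : W → Set (ℝ × ℝ)) (a : W)
    (old : ∀ b, b < a → Set (ℝ × ℝ)) : Set (ℝ × ℝ) :=
  {q | q ∈ lineThrough l.1 l.2 ∧
    (∀ b hb, ∀ c hc, ∀ x ∈ old b hb, ∀ y ∈ old c hc, q ∉ lineThrough x (y - x)) ∧
    ∀ b < a, NullOnLine (F b) l.1 l.2 → q ∉ F b}

/-- The set of points, at most one, added at stage `a`. -/
def stage {W : Type} [LinearOrder W] [WellFoundedLT W] (l : W → (ℝ × ℝ) × (ℝ × ℝ)) (F : W → Set (ℝ × ℝ)) (a : W) : Set (ℝ × ℝ) :=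
  {q | ∃ h : (admissible (l a) F a fun b _ => stage l F b).Nonempty, q = h.some}
termination_by wellFounded_lt.wrap a
decreasing_by assumption

variable (l : W → (ℝ × ℝ) × (ℝ × ℝ)) (F : W → Set (ℝ × ℝ))

lemma stage_subsingleton (a : W) : (stage l F a).Subsingleton := by
  intro x hx y hy
  rw [stage] at hx hy
  obtain ⟨_, rfl⟩ := hx
  obtain ⟨_, rfl⟩ := hy
  rfl

lemma stage_subset_admissible (a : W) :
    stage l F a ⊆ admissible (l a) F a fun b _ => stage l F b := by
  intro x hx
  rw [stage] at hx
  obtain ⟨h, rfl⟩ := hx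
  exact h.some_mem

variable {l F}

lemma notMem_lineThrough_of_mem_stage {a b c : W} (hb : b < a) (hc : c < a) {x y z : ℝ × ℝ}
    (hx : x ∈ stage l F b) (hy : y ∈ stage l F c) (hz : z ∈ stage l F a) :
    z ∉ lineThrough x (y - x) :=
  (stage_subset_admissible l F a hz).2.1 b hb c hc x hx y hy

lemma ne_of_mem_stage {a b : W} (hb : b < a) {x z : ℝ × ℝ} (hx : x ∈ stage l F b)
    (hz : z ∈ stage l F a) : x ≠ z := by
  rintro rfl
  exact notMem_lineThrough_of_mem_stage hb hb hx hx hz ⟨0, by simp⟩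

lemma stage_nonempty (hcov : CovNullEqContinuum) {a : W} (ha : #(Iio a) < continuum)
    (hv : (l a).2 ≠ 0)
    (hold : ∀ b < a, ∀ c < a, ∀ x ∈ stage l F b, ∀ y ∈ stage l F c,
      x ∈ lineThrough (l a).1 (l a).2 → y ∈ lineThrough (l a).1 (l a).2 → x = y) :
    (stage l F a).Nonempty := by
  suffices h : (admissible (l a) F a fun b _ => stage l F b).Nonempty by
    rw [stage]
    exact ⟨h.some, h, rfl⟩
  set p := (l a).1
  set v := (l a).2
  let A (i : Iio a × Iio a) : Set ℝ :=
    {t | NullOnLine (F i.1) p v ∧ p + t • v ∈ F i.1} ∪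
    {t | ∃ x ∈ stage l F i.1, ∃ y ∈ stage l F i.2, p + t • v ∈ lineThrough x (y - x)}
  have hA : (⋃ i, A i) ≠ Set.univ := by
    refine hcov _ A ?_ fun i => measure_union_null ?_ ?_
    · rw [mk_prod, lift_id]
      exact mul_lt_of_lt aleph0_le_continuum ha ha
    · by_cases h : NullOnLine (F i.1) p v
      · exact measure_mono_null (fun t ht => ht.2) h
      · simp [h]
    · refine Subsingleton.measure_zero ?_ _
      rintro s ⟨x, hx, y, hy, hs⟩ t ⟨x', hx', y', hy', ht⟩
      obtain rfl := stage_subsingleton l F _ hx hx'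
      obtain rfl := stage_subsingleton l F _ hy hy'
      by_contra hst
      have hne : p + s • v ≠ p + t • v := fun h =>
        hst (smul_left_injective ℝ hv (add_left_cancel h))
      have hL : lineThrough p v = lineThrough x (y - x) :=
        (lineThrough_eq_of_mem ⟨s, rfl⟩ ⟨t, rfl⟩ hne).trans (lineThrough_eq_of_mem hs ht hne).symm
      have hxy : x = y := hold _ i.1.2 _ i.2.2 x hx y hy (hL ▸ ⟨0, by simp⟩)
        (hL ▸ ⟨1, by simp⟩)
      subst hxy
      obtain ⟨_, h1⟩ := hs
      obtain ⟨_, h2⟩ := ht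
      exact hne (by simp [h1, h2])
  obtain ⟨t, ht⟩ := (ne_univ_iff_exists_notMem _).1 hA
  simp only [mem_iUnion, not_exists] at ht
  refine ⟨p + t • v, ⟨t, rfl⟩, fun b hb c hc x hx y hy h => ?_, fun b hb hn h => ?_⟩
  · exact ht (⟨b, hb⟩, ⟨c, hc⟩) (Or.inr ⟨x, hx, y, hy, h⟩)
  · exact ht (⟨b, hb⟩, ⟨b, hb⟩) (Or.inl ⟨hn, h⟩)

lemma not_collinear_of_mem_stage {L : Set (ℝ × ℝ)} (hL : IsLine L) {a b c : W} {x y z : ℝ × ℝ}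
    (hx : x ∈ stage l F a) (hy : y ∈ stage l F b) (hz : z ∈ stage l F c)
    (hxL : x ∈ L) (hyL : y ∈ L) (hzL : z ∈ L) (hxy : x ≠ y) (hxz : x ≠ z) (hyz : y ≠ z) :
    False := by
  have hne {a b : W} {x y : ℝ × ℝ} (hx : x ∈ stage l F a) (hy : y ∈ stage l F b) (h : x ≠ y) :
      a ≠ b := by
    rintro rfl
    exact h (stage_subsingleton l F _ hx hy)
  have last {a b c : W} {x y z : ℝ × ℝ} (hx : x ∈ stage l F a) (hy : y ∈ stage l F b)
      (hz : z ∈ stage l F c) (hxL : x ∈ L) (hyL : y ∈ L) (hzL : z ∈ L) (hxy : x ≠ y)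
      (hac : a < c) (hbc : b < c) : False :=
    notMem_lineThrough_of_mem_stage hac hbc hx hy hz (hL.eq_lineThrough hxL hyL hxy ▸ hzL)
  rcases lt_or_gt_of_ne (hne hx hy hxy) with hab | hab <;>
  rcases lt_or_gt_of_ne (hne hx hz hxz) with hac | hac <;>
  rcases lt_or_gt_of_ne (hne hy hz hyz) with hbc | hbc
  all_goals first
    | exact last hx hy hz hxL hyL hzL hxy ‹_› ‹_›
    | exact last hx hz hy hxL hzL hyL hxz ‹_› ‹_›
    | exact last hy hz hx hyL hzL hxL hyz ‹_› ‹_›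
    | exact absurd (hab.trans hbc) hac.asymm
    | exact absurd (hbc.trans hab) hac.asymm

lemma isMazurkiewicz_iUnion_stage (hcov : CovNullEqContinuum)
    (hW : ∀ a : W, #(Iio a) < continuum) (hl : ∀ p v, v ≠ 0 → ∃ a b, a < b ∧ l a = (p, v) ∧ l b = (p, v)) :
    IsMazurkiewicz (⋃ a, stage l F a) := by
  intro L hL
  obtain ⟨x, ⟨⟨a, hxa⟩, hxL⟩, y, ⟨⟨b, hyb⟩, hyL⟩, hxy⟩ :
      ∃ x, ((∃ a, x ∈ stage l F a) ∧ x ∈ L) ∧ ∃ y, ((∃ a, y ∈ stage l F a) ∧ y ∈ L) ∧ x ≠ y := by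
    obtain ⟨p, v, hv, rfl⟩ := hL
    obtain ⟨a, b, hab, ha, hb⟩ := hl p v hv
    by_contra! hcon
    have hnonempty {c : W} (hc : l c = (p, v)) :
        ∃ x ∈ stage l F c, x ∈ lineThrough p v := by
      obtain ⟨x, hx⟩ := stage_nonempty (F := F) hcov (hW c) (by simpa [hc] using hv)
        (fun d _ e _ x hx y hy hxL hyL => hcon x ⟨⟨d, hx⟩, by simpa [hc] using hxL⟩ y
          ⟨⟨e, hy⟩, by simpa [hc] using hyL⟩)
      exact ⟨x, hx, by simpa [hc] using (stage_subset_admissible l F c hx).1⟩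
    obtain ⟨x, hx, hxL⟩ := hnonempty ha
    obtain ⟨y, hy, hyL⟩ := hnonempty hb
    exact ne_of_mem_stage hab hx hy (hcon x ⟨⟨a, hx⟩, hxL⟩ y ⟨⟨b, hy⟩, hyL⟩)
  have : (⋃ a, stage l F a) ∩ L = {x, y} := by
    ext z
    simp only [mem_inter_iff, mem_iUnion, mem_insert_iff, mem_singleton_iff]
    constructor
    · rintro ⟨⟨c, hzc⟩, hzL⟩
      by_contra! h
      exact not_collinear_of_mem_stage hL hxa hyb hzc hxL hyL hzL hxy h.1.symm h.2.symm
    · rintro (rfl | rfl)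
      · exact ⟨⟨a, hxa⟩, hxL⟩
      · exact ⟨⟨b, hyb⟩, hyL⟩
  rw [this, encard_pair hxy]

lemma mk_iUnion_stage_inter_lt (hW : ∀ a : W, #(Iio a) < continuum) (hl : ∀ a, (l a).2 ≠ 0)
    (hM : IsMazurkiewicz (⋃ a, stage l F a)) (a : W)
    (hF : {L | ∃ p v, v ≠ 0 ∧ L = lineThrough p v ∧ ¬ NullOnLine (F a) p v}.Countable) :
    #↥((⋃ b, stage l F b) ∩ F a) < continuum := by
  set B := {L | ∃ p v, v ≠ 0 ∧ L = lineThrough p v ∧ ¬ NullOnLine (F a) p v}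
  have hsub : (⋃ b, stage l F b) ∩ F a ⊆
      (⋃ b : Iio a, stage l F b) ∪ (stage l F a ∪ ⋃ L ∈ B, (⋃ b, stage l F b) ∩ L) := by
    rintro x ⟨hx, hxF⟩
    obtain ⟨b, hb⟩ := mem_iUnion.1 hx
    rcases lt_trichotomy b a with h | rfl | h
    · exact Or.inl (mem_iUnion.2 ⟨⟨b, h⟩, hb⟩)
    · exact Or.inr (Or.inl hb)
    · refine Or.inr (Or.inr (mem_biUnion ?_ ⟨hx, (stage_subset_admissible l F b hb).1⟩))
      exact ⟨_, _, hl b, rfl, fun hn => (stage_subset_admissible l F b hb).2.2 a h hn hxF⟩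
  have hcount : (stage l F a ∪ ⋃ L ∈ B, (⋃ b, stage l F b) ∩ L).Countable := by
    refine (stage_subsingleton l F a).countable.union (hF.biUnion fun L hL => ?_)
    obtain ⟨p, v, hv, rfl, -⟩ := hL
    refine (finite_of_encard_le_coe (k := 2) ?_).countable
    exact (hM _ ⟨p, v, hv, rfl⟩).le
  have hold : #(⋃ b : Iio a, stage l F b) < continuum := by
    refine lt_of_le_of_lt (mk_le_of_surjective (α := {b : Iio a // (stage l F b).Nonempty})
      (f := fun b => ⟨b.2.some, mem_iUnion.2 ⟨b.1, b.2.some_mem⟩⟩) ?_)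
      ((mk_subtype_le _).trans_lt (hW a))
    rintro ⟨x, hx⟩
    obtain ⟨b, hb⟩ := mem_iUnion.1 hx
    exact ⟨⟨b, x, hb⟩, Subtype.ext (stage_subsingleton l F _ (Set.Nonempty.some_mem _) hb)⟩
  refine (mk_le_mk_of_subset hsub).trans_lt ((mk_union_le _ _).trans_lt ?_)
  exact add_lt_of_lt aleph0_le_continuum hold
    ((le_aleph0_iff_set_countable.2 hcount).trans_lt aleph0_lt_continuum)

end Construction

/-- The first coordinate after rotation by `θ`. -/
def rotFst (θ : ℝ) : ℝ × ℝ →ₗ[ℝ] ℝ :=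
  Real.cos θ • LinearMap.fst ℝ ℝ ℝ - Real.sin θ • LinearMap.snd ℝ ℝ ℝ

lemma rotFst_apply (θ : ℝ) (p : ℝ × ℝ) : rotFst θ p = (rot θ p).1 := by
  simp [rotFst, rot, mul_comm]

lemma countable_not_nullOnLine_rot (θ : ℝ) (d : ℕ → ℝ × ℝ) :
    {L | ∃ p v, v ≠ 0 ∧ L = lineThrough p v ∧
      ¬ NullOnLine (rot θ ⁻¹' limitGraph d) p v}.Countable := by
  refine countable_not_nullOnLine ?_ (rotFst θ) fun x hx y hy h => ?_
  · refine (?_ : Measurable (rot θ)) (measurableSet_limitGraph d)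
    unfold rot
    fun_prop
  · rw [rotFst_apply, rotFst_apply] at h
    exact Function.LeftInverse.injective (rot_neg_rot θ) (injOn_fst_limitGraph d hx hy h)

/-- Assuming `cov(𝒩) = 𝔠`, there is a Mazurkiewicz set whose every rotation is both
a Mazurkiewicz set and a Sierpiński–Zygmund set. -/
theorem stmt_15 (hcov : CovNullEqContinuum) :
    ∃ M : Set (ℝ × ℝ), IsMazurkiewicz M ∧
      ∀ θ : ℝ, IsMazurkiewicz (rot θ '' M) ∧ IsSZSet (rot θ '' M) := by
  let W := (continuum.{0}).ord.ToType
  have hW : #W = continuum := mk_ord_toType _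
  have hWlt (a : W) : #(Iio a) < continuum :=
    (mk_Iio_lt a (by simp [W])).trans_eq hW
  obtain ⟨e⟩ : Nonempty (W ≃ ((ℝ × ℝ) × (ℝ × ℝ)) × Bool) := Cardinal.eq.1 (by
    rw [hW]
    simp [mk_real])
  obtain ⟨c⟩ : Nonempty (W ≃ ℝ × (ℕ → ℝ × ℝ)) := Cardinal.eq.1 (by
    rw [hW]
    simp [mk_real])
  let l (a : W) : (ℝ × ℝ) × (ℝ × ℝ) :=
    ((e a).1.1, if (e a).1.2 = 0 then (1, 0) else (e a).1.2)
  let F (a : W) : Set (ℝ × ℝ) := rot (c a).1 ⁻¹' limitGraph (c a).2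
  have hl (a : W) : (l a).2 ≠ 0 := by
    by_cases h : (e a).1.2 = 0 <;> simp [l, h]
  have hM : IsMazurkiewicz (⋃ a, stage l F a) := by
    refine isMazurkiewicz_iUnion_stage hcov hWlt fun p v hv => ?_
    have hlv (i : Bool) : l (e.symm ((p, v), i)) = (p, v) := by simp [l, hv]
    have hne : e.symm ((p, v), false) ≠ e.symm ((p, v), true) := by simp
    rcases lt_or_gt_of_ne hne with h | h
    · exact ⟨_, _, h, hlv _, hlv _⟩
    · exact ⟨_, _, h, hlv _, hlv _⟩
  refine ⟨_, hM, fun θ => ⟨hM.image_rot θ, fun S g hg => ?_⟩⟩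
  rcases S.eq_empty_or_nonempty with rfl | hS
  · have : _root_.graphOn ∅ g = ∅ := by
      ext
      simp [_root_.graphOn]
    rw [this, inter_empty, mk_eq_zero]
    exact continuum_pos
  obtain ⟨d, hd⟩ := exists_graphOn_subset_limitGraph S g hg hS
  have hF : F (c.symm (θ, d)) = rot θ ⁻¹' limitGraph d := by simp [F]
  have hlt := mk_iUnion_stage_inter_lt hWlt hl hM (c.symm (θ, d))
    (hF ▸ countable_not_nullOnLine_rot θ d)
  rw [hF] at hlt
  have hsub : (rot θ '' ⋃ a, stage l F a) ∩ _root_.graphOn S g ⊆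
      rot θ '' ((⋃ a, stage l F a) ∩ rot θ ⁻¹' limitGraph d) := by
    rw [image_inter_preimage]
    exact inter_subset_inter_right _ hd
  exact ((mk_le_mk_of_subset hsub).trans mk_image_le).trans_lt hlt
end
end

section
/- There exists a Mazurkiewicz set M ⊆ ℝ × ℝ such that for every θ ∈ {0, π/2, π, 3π/2} there exist Hamel functions f_θ g_θ : ℝ → ℝ with ρ_θ(M) = {(x, f_θ x) | x ∈ ℝ} ∪ {(x, g_θ x) | x ∈ ℝ}. -/
open Cardinal Set

noncomputable section

/-- Transfinite induction: if a property `Good` of finite character can be kept while performing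
any single task by adding finitely many elements to a set of cardinality less than `κ`, then some
good set performs `κ` many tasks at once. -/
theorem exists_good_forall_done {X T : Type} {κ : Cardinal.{0}} (hκ : ℵ₀ < κ) (hT : #T ≤ κ)
    {Good : Set X → Prop} {Done : T → Set X → Prop} (good_empty : Good ∅)
    (good_mono : ∀ ⦃U V⦄, U ⊆ V → Good V → Good U)
    (good_of_finite : ∀ U, (∀ F ⊆ U, F.Finite → Good F) → Good U)
    (done_mono : ∀ τ ⦃U V⦄, U ⊆ V → Done τ U → Done τ V)
    (extend : ∀ U τ, Good U → #U < κ → ∃ V : Set X, V.Finite ∧ Good (U ∪ V) ∧ Done τ (U ∪ V)) :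
    ∃ U, Good U ∧ ∀ τ, Done τ U := by
  obtain ⟨_, _, hord⟩ := Cardinal.exists_ord_eq_type_lt T
  have step : ∀ U τ, ∃ V : Set X, V.Finite ∧
      (Good U → #U < κ → Good (U ∪ V) ∧ Done τ (U ∪ V)) := by
    intro U τ
    by_cases h : Good U ∧ #U < κ
    · obtain ⟨V, hV, h'⟩ := extend U τ h.1 h.2
      exact ⟨V, hV, fun _ _ => h'⟩
    · exact ⟨∅, finite_empty, fun h₁ h₂ => absurd ⟨h₁, h₂⟩ h⟩
  choose F hfin hF using step
  let S : T → Set X := (wellFounded_lt (α := T)).fix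
    (fun τ ih => F (⋃ σ, ⋃ h : σ < τ, ih σ h) τ)
  have hS : ∀ τ, S τ = F (⋃ σ ∈ Iio τ, S σ) τ := fun τ => WellFounded.fix_eq _ _ _
  have hcard : ∀ τ, #(⋃ σ ∈ Iio τ, S σ : Set X) < κ := by
    intro τ
    refine (Cardinal.mk_biUnion_le _ _).trans_lt ?_
    refine Cardinal.mul_lt_of_lt hκ.le ((Cardinal.mk_Iio_lt τ hord).trans_le hT)
      (lt_of_le_of_lt (ciSup_le' fun σ => ?_) hκ)
    rw [hS]
    exact (hfin _ _).countable.le_aleph0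
  have finite_sub : ∀ I : Set T, (∀ σ ∈ I, Good ((⋃ ρ ∈ Iio σ, S ρ) ∪ S σ)) →
      Good (⋃ σ ∈ I, S σ) := by
    intro I hI
    refine good_of_finite _ fun G hG hGfin => ?_
    rcases G.eq_empty_or_nonempty with rfl | hne
    · exact good_empty
    have : ∀ x : G, ∃ σ ∈ I, (x : X) ∈ S σ := fun x => by simpa using hG x.2
    choose g hgI hg using this
    have := hGfin.to_subtype
    have := hne.to_subtype
    obtain ⟨m, hm⟩ := Finite.exists_max g
    refine good_mono (fun x hx => ?_) (hI (g m) (hgI m))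
    rcases (hm ⟨x, hx⟩).lt_or_eq with h | h
    · exact Or.inl (mem_biUnion (mem_Iio.2 h) (hg ⟨x, hx⟩))
    · exact Or.inr (h ▸ hg ⟨x, hx⟩)
  have stage : ∀ τ, Good ((⋃ σ ∈ Iio τ, S σ) ∪ S τ) ∧ Done τ ((⋃ σ ∈ Iio τ, S σ) ∪ S τ) := by
    intro τ
    induction τ using WellFoundedLT.induction with
    | ind τ ih =>
      rw [hS τ]
      exact hF _ _ (finite_sub _ fun σ hσ => (ih σ hσ).1) (hcard τ)
  refine ⟨⋃ σ ∈ Set.univ, S σ, finite_sub _ fun σ _ => (stage σ).1, fun τ =>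
    done_mono τ (union_subset ?_ ?_) (stage τ).2⟩
  · exact biUnion_subset_biUnion_left (subset_univ _)
  · exact subset_biUnion_of_mem (u := S) (mem_univ τ)

theorem mk_setOf_exists_lt_continuum {α β : Type} {s : Set α} {P : α → β → Prop}
    (hs : #s < continuum) (hP : ∀ a ∈ s, {t | P a t}.Countable) :
    #{t | ∃ a ∈ s, P a t} < continuum := by
  have : {t | ∃ a ∈ s, P a t} = ⋃ a ∈ s, {t | P a t} := by ext; simp
  rw [this]
  refine (Cardinal.mk_biUnion_le _ _).trans_lt ?_
  exact Cardinal.mul_lt_of_lt aleph0_le_continuum hs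
    (lt_of_le_of_lt (ciSup_le' fun a => (hP a a.2).le_aleph0) aleph0_lt_continuum)

theorem mk_union_lt_continuum {β : Type} {s t : Set β} (hs : #s < continuum)
    (ht : #t < continuum) : #(s ∪ t : Set β) < continuum :=
  (Cardinal.mk_union_le s t).trans_lt (Cardinal.add_lt_of_lt aleph0_le_continuum hs ht)

theorem mk_span_rat_lt_continuum {V : Type} [AddCommGroup V] [Module ℚ V] {s : Set V}
    (hs : #s < continuum) : #(Submodule.span ℚ s) < continuum := by
  have h : #(Submodule.span ℚ s) ≤ #(s →₀ ℚ) := by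
    refine Cardinal.mk_le_of_surjective (f := fun c => ⟨Finsupp.linearCombination ℚ (↑) c, ?_⟩) ?_
    · rw [Finsupp.mem_span_iff_linearCombination]
      exact ⟨c, rfl⟩
    · rintro ⟨x, hx⟩
      obtain ⟨c, hc⟩ := (Finsupp.mem_span_iff_linearCombination ℚ s x).1 hx
      exact ⟨c, Subtype.ext hc⟩
  refine h.trans_lt ?_
  rcases isEmpty_or_nonempty s with _ | _
  · exact (Cardinal.le_one_iff_subsingleton.2 inferInstance).trans_lt
      (one_lt_aleph0.trans aleph0_lt_continuum)
  · rw [Cardinal.mk_finsupp_of_infinite']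
    exact max_lt hs (by simpa using aleph0_lt_continuum)

theorem finite_setOf_quadratic_eq_zero {a b c : ℝ} (h : a ≠ 0 ∨ b ≠ 0 ∨ c ≠ 0) :
    {t : ℝ | a * t ^ 2 + b * t + c = 0}.Finite := by
  open Polynomial in
  have hp : (C a * X ^ 2 + C b * X + C c : ℝ[X]) ≠ 0 := by
    intro h0
    have h2 := congrArg (fun p => coeff p 2) h0
    have h1 := congrArg (fun p => coeff p 1) h0
    have h3 := congrArg (fun p => coeff p 0) h0
    simp [coeff_X, coeff_C] at h1 h2 h3
    tauto
  refine (Polynomial.finite_setOfPred_isRoot hp).subset fun t ht => ?_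
  simpa [Polynomial.IsRoot] using ht

/-- Twice the signed area of the triangle `p q r`; it vanishes iff the points are collinear. -/
def signedArea (p q r : ℝ × ℝ) : ℝ :=
  (q.1 - p.1) * (r.2 - p.2) - (q.2 - p.2) * (r.1 - p.1)

/-- The points of `U` of colour `b`. -/
def colour (U : Set ((ℝ × ℝ) × Bool)) (b : Bool) : Set (ℝ × ℝ) := {p | (p, b) ∈ U}

/-- A two-coloured partial Mazurkiewicz set, each of whose colours is linearly independent over `ℚ`
and meets every vertical and every horizontal line at most once. -/
structure IsPartialMazurkiewicz (U : Set ((ℝ × ℝ) × Bool)) : Prop where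
  colour_unique : ∀ x ∈ U, ∀ y ∈ U, x.1 = y.1 → x.2 = y.2
  not_collinear : ∀ x ∈ U, ∀ y ∈ U, ∀ z ∈ U, x.1 ≠ y.1 → x.1 ≠ z.1 → y.1 ≠ z.1 →
    signedArea x.1 y.1 z.1 ≠ 0
  fst_inj : ∀ x ∈ U, ∀ y ∈ U, x.2 = y.2 → x.1.1 = y.1.1 → x.1 = y.1
  snd_inj : ∀ x ∈ U, ∀ y ∈ U, x.2 = y.2 → x.1.2 = y.1.2 → x.1 = y.1
  linearIndepOn : ∀ b, LinearIndepOn ℚ id (colour U b)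

namespace IsPartialMazurkiewicz

variable {U V : Set ((ℝ × ℝ) × Bool)}

theorem empty : IsPartialMazurkiewicz ∅ where
  colour_unique := by simp
  not_collinear := by simp
  fst_inj := by simp
  snd_inj := by simp
  linearIndepOn b := by simp [colour]

theorem mono (h : U ⊆ V) (hV : IsPartialMazurkiewicz V) : IsPartialMazurkiewicz U where
  colour_unique x hx y hy := hV.colour_unique x (h hx) y (h hy)
  not_collinear x hx y hy z hz := hV.not_collinear x (h hx) y (h hy) z (h hz)
  fst_inj x hx y hy := hV.fst_inj x (h hx) y (h hy)
  snd_inj x hx y hy := hV.snd_inj x (h hx) y (h hy)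
  linearIndepOn b := (hV.linearIndepOn b).mono fun _ hp => h hp

theorem of_finite (h : ∀ F ⊆ U, F.Finite → IsPartialMazurkiewicz F) : IsPartialMazurkiewicz U := by
  have triple : ∀ x ∈ U, ∀ y ∈ U, ∀ z ∈ U, IsPartialMazurkiewicz {x, y, z} :=
    fun x hx y hy z hz => h _ (by simp [insert_subset_iff, hx, hy, hz]) (by simp)
  refine ⟨fun x hx y hy => ?_, fun x hx y hy z hz => ?_, fun x hx y hy => ?_,
    fun x hx y hy => ?_, fun b => linearIndepOn_of_finite _ fun t ht htfin => ?_⟩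
  · exact (triple x hx y hy y hy).colour_unique x (by simp) y (by simp)
  · exact (triple x hx y hy z hz).not_collinear x (by simp) y (by simp) z (by simp)
  · exact (triple x hx y hy y hy).fst_inj x (by simp) y (by simp)
  · exact (triple x hx y hy y hy).snd_inj x (by simp) y (by simp)
  · refine ((h ((fun p => (p, b)) '' t) ?_ (htfin.image _)).linearIndepOn b).mono ?_
    · rintro _ ⟨p, hp, rfl⟩
      exact ht hp
    · exact fun p hp => ⟨p, hp, rfl⟩

theorem insert_of_generic (hU : IsPartialMazurkiewicz U) {p : ℝ × ℝ} {b : Bool}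
    (hp : ∀ x ∈ U, x.1 ≠ p)
    (harea : ∀ x ∈ U, ∀ y ∈ U, x.1 ≠ y.1 → signedArea x.1 y.1 p ≠ 0)
    (hfst : ∀ x ∈ U, x.2 = b → x.1.1 ≠ p.1) (hsnd : ∀ x ∈ U, x.2 = b → x.1.2 ≠ p.2)
    (hspan : p ∉ Submodule.span ℚ (colour U b)) :
    IsPartialMazurkiewicz (insert (p, b) U) where
  colour_unique := by
    rintro x (rfl | hx) y (rfl | hy) h
    · rfl
    · exact absurd h.symm (hp y hy)
    · exact absurd h (hp x hx)
    · exact hU.colour_unique x hx y hy h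
  not_collinear := by
    have rotate : ∀ p q r, signedArea p q r = signedArea q r p := by
      intros; simp only [signedArea]; ring
    rintro x (rfl | hx) y (rfl | hy) z (rfl | hz) hxy hxz hyz
    any_goals first | exact absurd rfl hxy | exact absurd rfl hxz | exact absurd rfl hyz
    · rw [rotate]
      exact harea y hy z hz hyz
    · rw [rotate, rotate]
      exact harea z hz x hx hxz.symm
    · exact harea x hx y hy hxy
    · exact hU.not_collinear x hx y hy z hz hxy hxz hyz
  fst_inj := by
    rintro x (rfl | hx) y (rfl | hy) hb h
    · rfl
    · exact absurd h.symm (hfst y hy hb.symm)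
    · exact absurd h (hfst x hx hb)
    · exact hU.fst_inj x hx y hy hb h
  snd_inj := by
    rintro x (rfl | hx) y (rfl | hy) hb h
    · rfl
    · exact absurd h.symm (hsnd y hy hb.symm)
    · exact absurd h (hsnd x hx hb)
    · exact hU.snd_inj x hx y hy hb h
  linearIndepOn c := by
    by_cases hc : c = b
    · subst hc
      have : colour (insert (p, c) U) c = insert p (colour U c) := by
        ext q; simp [colour]
      rw [this]
      exact (hU.linearIndepOn c).id_insert hspan
    · have : colour (insert (p, b) U) c = colour U c := by
        ext q; simp [colour, hc]
      rw [this]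
      exact hU.linearIndepOn c

theorem mk_colour_lt (h : #U < continuum) (b : Bool) : #(colour U b) < continuum := by
  refine (Cardinal.mk_le_of_injective (f := fun p => (⟨(p.1, b), p.2⟩ : U)) ?_).trans_lt h
  intro p q hpq
  simpa [Subtype.ext_iff] using hpq

theorem mk_pairs_lt (h : #U < continuum) : #(U ×ˢ U : Set _) < continuum := by
  rw [Cardinal.mk_setProd]
  simpa using Cardinal.mul_lt_of_lt aleph0_le_continuum h h

end IsPartialMazurkiewicz

theorem exists_notMem_of_mk_lt_continuum {s : Set ℝ} (hs : #s < continuum) : ∃ t, t ∉ s := by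
  by_contra! h
  rw [eq_univ_of_forall h, mk_univ, mk_real] at hs
  exact hs.false

theorem mem_lineThrough_iff {p v q : ℝ × ℝ} (hv : v ≠ 0) :
    q ∈ lineThrough p v ↔ (q.1 - p.1) * v.2 = (q.2 - p.2) * v.1 := by
  obtain ⟨v₁, v₂⟩ := v
  obtain ⟨p₁, p₂⟩ := p
  obtain ⟨q₁, q₂⟩ := q
  simp only [lineThrough, mem_ofPred_eq, Prod.smul_mk, Prod.mk_add_mk, Prod.mk.injEq, smul_eq_mul]
  constructor
  · rintro ⟨t, rfl, rfl⟩
    ring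
  · intro h
    by_cases h₁ : v₁ = 0
    · have h₂ : v₂ ≠ 0 := by
        rintro rfl
        exact hv (by simp [h₁])
      refine ⟨(q₂ - p₂) / v₂, ?_, by field_simp; ring⟩
      subst h₁
      have : q₁ - p₁ = 0 := by simpa [h₂] using h
      linarith
    · refine ⟨(q₁ - p₁) / v₁, by field_simp; ring, ?_⟩
      field_simp
      linarith

/-- A line that lacks colour `b` and carries at most one point of `U` has room for a new point of
colour `b`. -/
theorem IsPartialMazurkiewicz.exists_insert_mem_line {U : Set ((ℝ × ℝ) × Bool)}
    (hU : IsPartialMazurkiewicz U) (hcard : #U < continuum) {p v : ℝ × ℝ} (hv : v ≠ 0) {b : Bool}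
    (hb : ∀ x ∈ U, x.2 = b → x.1 ∉ lineThrough p v)
    (hsub : ∀ x ∈ U, ∀ y ∈ U, x.1 ∈ lineThrough p v → y.1 ∈ lineThrough p v → x.1 = y.1) :
    ∃ q ∈ lineThrough p v, IsPartialMazurkiewicz (insert (q, b) U) := by
  have hfiber : ∀ q : ℝ × ℝ, {t : ℝ | q = p + t • v}.Countable := by
    intro q
    refine Set.Subsingleton.countable fun t ht s hs => ?_
    have : t • v = s • v := add_left_cancel (ht.symm.trans hs)
    exact smul_left_injective ℝ hv this
  have harea : ∀ x ∈ U, ∀ y ∈ U,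
      {t : ℝ | x.1 ≠ y.1 ∧ signedArea x.1 y.1 (p + t • v) = 0}.Countable := by
    intro x hx y hy
    by_cases hxy : x.1 = y.1
    · simp [hxy]
    refine Set.Countable.mono ?_ (finite_setOf_quadratic_eq_zero (a := 0)
      (b := (y.1.1 - x.1.1) * v.2 - (y.1.2 - x.1.2) * v.1) (c := signedArea x.1 y.1 p) ?_).countable
    · rintro t ⟨-, ht⟩
      simp only [signedArea, Prod.fst_add, Prod.snd_add, Prod.smul_fst, Prod.smul_snd,
        smul_eq_mul, mem_ofPred_eq] at ht ⊢
      linarith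
    · by_contra! h
      obtain ⟨-, h₁, h₂⟩ := h
      simp only [signedArea] at h₂
      have hne : y.1.1 - x.1.1 ≠ 0 ∨ y.1.2 - x.1.2 ≠ 0 := by
        by_contra! h
        exact hxy (Prod.ext (by linarith [h.1]) (by linarith [h.2]))
      have hxL : x.1 ∈ lineThrough p v := by
        rw [mem_lineThrough_iff hv]
        rcases hne with h | h <;> apply mul_left_cancel₀ h <;> grind
      refine hxy (hsub x hx y hy hxL ?_)
      rw [mem_lineThrough_iff hv] at hxL ⊢
      linarith
  have hfst : ∀ x ∈ U, {t : ℝ | x.2 = b ∧ x.1.1 = p.1 + t * v.1}.Countable := by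
    intro x hx
    by_cases hxb : x.2 = b
    · refine Set.Countable.mono ?_ (finite_setOf_quadratic_eq_zero (a := 0)
        (b := v.1) (c := p.1 - x.1.1) ?_).countable
      · rintro t ⟨-, ht⟩
        simp only [mem_ofPred_eq]
        linarith
      · by_contra! h
        refine hb x hx hxb ((mem_lineThrough_iff hv).2 ?_)
        rw [h.2.1]
        linear_combination -v.2 * h.2.2
    · simp [hxb]
  have hsnd : ∀ x ∈ U, {t : ℝ | x.2 = b ∧ x.1.2 = p.2 + t * v.2}.Countable := by
    intro x hx
    by_cases hxb : x.2 = b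
    · refine Set.Countable.mono ?_ (finite_setOf_quadratic_eq_zero (a := 0)
        (b := v.2) (c := p.2 - x.1.2) ?_).countable
      · rintro t ⟨-, ht⟩
        simp only [mem_ofPred_eq]
        linarith
      · by_contra! h
        refine hb x hx hxb ((mem_lineThrough_iff hv).2 ?_)
        rw [h.2.1]
        linear_combination v.1 * h.2.2
    · simp [hxb]
  have hbad := mk_union_lt_continuum
    (mk_union_lt_continuum
      (mk_setOf_exists_lt_continuum (P := fun (x : (ℝ × ℝ) × Bool) t => (x.1 = p + t • v ∨
          (x.2 = b ∧ x.1.1 = p.1 + t * v.1)) ∨ (x.2 = b ∧ x.1.2 = p.2 + t * v.2)) hcard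
        fun x hx => ((hfiber x.1).union (hfst x hx)).union (hsnd x hx))
      (mk_setOf_exists_lt_continuum (IsPartialMazurkiewicz.mk_pairs_lt hcard)
        fun xy hxy => harea xy.1 hxy.1 xy.2 hxy.2))
    (mk_setOf_exists_lt_continuum
      (mk_span_rat_lt_continuum (IsPartialMazurkiewicz.mk_colour_lt hcard b))
      fun q _ => hfiber q)
  obtain ⟨t, ht⟩ := exists_notMem_of_mk_lt_continuum hbad
  simp only [mem_union, mem_ofPred_eq, not_or, not_exists, not_and] at ht
  obtain ⟨⟨h₁, h₂⟩, h₃⟩ := ht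
  refine ⟨p + t • v, ⟨t, rfl⟩, hU.insert_of_generic (fun x hx => (h₁ x hx).1.1)
    (fun x hx y hy hxy h => h₂ (x, y) ⟨hx, hy⟩ hxy h) (fun x hx hxb => (h₁ x hx).1.2 hxb)
    (fun x hx hxb => (h₁ x hx).2 hxb) fun h => h₃ _ h rfl⟩

/-- A vector in general position can be put into the span of a colour class by adding two points
whose difference is that vector. -/
theorem IsPartialMazurkiewicz.exists_insert_insert {U : Set ((ℝ × ℝ) × Bool)}
    (hU : IsPartialMazurkiewicz U) (hcard : #U < continuum) {v : ℝ × ℝ} (hv₁ : v.1 ≠ 0)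
    (hv₂ : v.2 ≠ 0) {b : Bool} (hv : v ∉ Submodule.span ℚ (colour U b)) :
    ∃ p, IsPartialMazurkiewicz (insert (p + v, b) (insert (p, b) U)) := by
  have hquad : ∀ {Q : ℝ → Prop} (a b c : ℝ), (a ≠ 0 ∨ b ≠ 0 ∨ c ≠ 0) →
      (∀ t, Q t → a * t ^ 2 + b * t + c = 0) → {t | Q t}.Countable :=
    fun a b c h hQ => (finite_setOf_quadratic_eq_zero h).countable.mono hQ
  have hsingle : ∀ x : (ℝ × ℝ) × Bool, {t : ℝ | x.1.1 = t ∨ x.1.2 = t ^ 2 ∨ x.1.1 = t + v.1 ∨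
      x.1.2 = t ^ 2 + v.2 ∨ signedArea x.1 (t, t ^ 2) ((t, t ^ 2) + v) = 0}.Countable := by
    intro x
    refine (hquad 0 1 (-x.1.1) (by simp) fun t ht => ?_).union <|
      (hquad 1 0 (-x.1.2) (by simp) fun t ht => ?_).union <|
      (hquad 0 1 (v.1 - x.1.1) (by simp) fun t ht => ?_).union <|
      (hquad 1 0 (v.2 - x.1.2) (by simp) fun t ht => ?_).union <|
      hquad (-v.1) v.2 (x.1.2 * v.1 - x.1.1 * v.2) (by simp [hv₁]) fun t ht => ?_
    · linarith
    · linarith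
    · linarith
    · linarith
    · simp only [signedArea, Prod.fst_add, Prod.snd_add] at ht
      linarith
  have hpair : ∀ (w : ℝ × ℝ) (x y : (ℝ × ℝ) × Bool),
      {t : ℝ | x.1 ≠ y.1 ∧ signedArea x.1 y.1 ((t, t ^ 2) + w) = 0}.Countable := by
    intro w x y
    by_cases hxy : x.1 = y.1
    · simp [hxy]
    refine hquad (y.1.1 - x.1.1) (x.1.2 - y.1.2)
      ((y.1.1 - x.1.1) * (w.2 - x.1.2) - (y.1.2 - x.1.2) * (w.1 - x.1.1)) ?_ fun t ht => ?_
    · by_contra! h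
      exact hxy (Prod.ext (by linarith [h.1]) (by linarith [h.2.1]))
    · have := ht.2
      simp only [signedArea, Prod.fst_add, Prod.snd_add] at this
      linarith
  have hspan : #(insert v (colour U b) : Set (ℝ × ℝ)) < continuum :=
    Cardinal.mk_insert_le.trans_lt (Cardinal.add_lt_of_lt aleph0_le_continuum
      (IsPartialMazurkiewicz.mk_colour_lt hcard b) (one_lt_aleph0.trans aleph0_lt_continuum))
  have hbad := mk_union_lt_continuum
    (mk_union_lt_continuum
      (mk_setOf_exists_lt_continuum hcard fun x _ => hsingle x)
      (mk_setOf_exists_lt_continuum (P := fun (xy : ((ℝ × ℝ) × Bool) × ((ℝ × ℝ) × Bool)) t =>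
          (xy.1.1 ≠ xy.2.1 ∧ signedArea xy.1.1 xy.2.1 ((t, t ^ 2) + 0) = 0) ∨
          (xy.1.1 ≠ xy.2.1 ∧ signedArea xy.1.1 xy.2.1 ((t, t ^ 2) + v) = 0))
        (IsPartialMazurkiewicz.mk_pairs_lt hcard) fun xy _ => (hpair 0 xy.1 xy.2).union (hpair v xy.1 xy.2)))
    (mk_setOf_exists_lt_continuum (P := fun q t => q = ((t, t ^ 2) : ℝ × ℝ))
      (mk_span_rat_lt_continuum hspan) fun q _ => hquad 0 1 (-q.1) (by simp) fun t ht => by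
        rw [ht]; ring)
  obtain ⟨t, ht⟩ := exists_notMem_of_mk_lt_continuum hbad
  simp only [mem_union, mem_ofPred_eq, not_or, not_exists, not_and, add_zero] at ht
  obtain ⟨⟨h₁, h₂⟩, h₃⟩ := ht
  have hp : IsPartialMazurkiewicz (insert ((t, t ^ 2), b) U) := by
    refine hU.insert_of_generic (fun x hx h => (h₁ x hx).1 (by rw [h]))
      (fun x hx y hy hxy => (h₂ (x, y) ⟨hx, hy⟩).1 hxy) (fun x hx _ => (h₁ x hx).1)
      (fun x hx _ => (h₁ x hx).2.1) fun h => h₃ _ ?_ rfl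
    exact Submodule.span_mono (subset_insert _ _) h
  refine ⟨(t, t ^ 2), hp.insert_of_generic ?_ ?_ ?_ ?_ ?_⟩
  · rintro x (rfl | hx) h
    · exact hv₁ (by simpa using congrArg Prod.fst h)
    · exact (h₁ x hx).2.2.1 (by rw [h]; rfl)
  · have swap : ∀ p q r, signedArea p q r = - signedArea q p r := by
      intros; simp only [signedArea]; ring
    rintro x (rfl | hx) y (rfl | hy) hxy
    · exact absurd rfl hxy
    · rw [swap]
      exact neg_ne_zero.2 (h₁ y hy).2.2.2.2
    · exact (h₁ x hx).2.2.2.2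
    · exact (h₂ (x, y) ⟨hx, hy⟩).2 hxy
  · rintro x (rfl | hx) _
    · simpa using hv₁
    · exact (h₁ x hx).2.2.1
  · rintro x (rfl | hx) _
    · simpa using hv₂
    · exact (h₁ x hx).2.2.2.1
  · have : colour (insert ((t, t ^ 2), b) U) b = insert (t, t ^ 2) (colour U b) := by
      ext q; simp [colour]
    rw [this]
    intro h
    refine h₃ (t, t ^ 2) (mem_span_insert_exchange ?_ hv) rfl
    simpa using Submodule.sub_mem _ h (Submodule.subset_span (mem_insert _ _))

/-- There is a two-coloured Mazurkiewicz set each of whose colours is a Hamel basis meeting every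
vertical and every horizontal line. -/
theorem exists_two_coloured_mazurkiewicz :
    ∃ U : Set ((ℝ × ℝ) × Bool), IsPartialMazurkiewicz U ∧
      (∀ b p v, v ≠ 0 → (∃ q ∈ lineThrough p v, (q, b) ∈ U) ∨
        (v.1 ≠ 0 ∧ v.2 ≠ 0 ∧ ∃ x ∈ U, ∃ y ∈ U, x.1 ∈ lineThrough p v ∧ y.1 ∈ lineThrough p v ∧
          x.1 ≠ y.1)) ∧
      ∀ b (v : ℝ × ℝ), v.1 ≠ 0 → v.2 ≠ 0 → v ∈ Submodule.span ℚ (colour U b) := by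
  let Done : (Bool × (ℝ × ℝ) × (ℝ × ℝ)) ⊕ (Bool × (ℝ × ℝ)) → Set ((ℝ × ℝ) × Bool) → Prop
    | .inl (b, p, v), U => v ≠ 0 → (∃ q ∈ lineThrough p v, (q, b) ∈ U) ∨
        (v.1 ≠ 0 ∧ v.2 ≠ 0 ∧ ∃ x ∈ U, ∃ y ∈ U, x.1 ∈ lineThrough p v ∧ y.1 ∈ lineThrough p v ∧
          x.1 ≠ y.1)
    | .inr (b, v), U => v.1 ≠ 0 → v.2 ≠ 0 → v ∈ Submodule.span ℚ (colour U b)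
  have done_mono : ∀ τ ⦃U V⦄, U ⊆ V → Done τ U → Done τ V := by
    rintro (⟨b, p, v⟩ | ⟨b, v⟩) U V hUV h
    · intro hv
      rcases h hv with ⟨q, hq, hqU⟩ | ⟨h₁, h₂, x, hx, y, hy, h⟩
      · exact Or.inl ⟨q, hq, hUV hqU⟩
      · exact Or.inr ⟨h₁, h₂, x, hUV hx, y, hUV hy, h⟩
    · exact fun h₁ h₂ => Submodule.span_mono (s := colour U b) (fun _ hp => hUV hp) (h h₁ h₂)
  have extend : ∀ U τ, IsPartialMazurkiewicz U → #U < continuum →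
      ∃ V : Set ((ℝ × ℝ) × Bool), V.Finite ∧ IsPartialMazurkiewicz (U ∪ V) ∧ Done τ (U ∪ V) := by
    rintro U τ hU hcard
    by_cases hdone : Done τ U
    · exact ⟨∅, finite_empty, by simpa using hU, by simpa using hdone⟩
    obtain ⟨b, p, v⟩ | ⟨b, v⟩ := τ
    · simp only [Done, not_forall, not_or, not_exists, not_and] at hdone
      obtain ⟨hv, hb, htwo⟩ := hdone
      have hb' : ∀ x ∈ U, x.2 = b → x.1 ∉ lineThrough p v := by
        rintro ⟨q, _⟩ hx rfl hq
        exact hb q hq hx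
      have hsub : ∀ x ∈ U, ∀ y ∈ U, x.1 ∈ lineThrough p v → y.1 ∈ lineThrough p v →
          x.1 = y.1 := by
        intro x hx y hy hxL hyL
        have hcol : x.2 = y.2 := by
          have h₁ := fun h => hb' x hx h hxL
          have h₂ := fun h => hb' y hy h hyL
          revert h₁ h₂
          cases x.2 <;> cases y.2 <;> cases b <;> simp
        have hxL' := (mem_lineThrough_iff hv).1 hxL
        have hyL' := (mem_lineThrough_iff hv).1 hyL
        by_cases hv₁ : v.1 = 0
        · have hv₂ : v.2 ≠ 0 := fun h => hv (Prod.ext hv₁ h)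
          refine hU.fst_inj x hx y hy hcol (mul_right_cancel₀ hv₂ ?_)
          rw [hv₁] at hxL' hyL'
          linarith
        by_cases hv₂ : v.2 = 0
        · refine hU.snd_inj x hx y hy hcol (mul_right_cancel₀ hv₁ ?_)
          rw [hv₂] at hxL' hyL'
          linarith
        · exact not_not.1 (htwo hv₁ hv₂ x hx y hy hxL hyL)
      obtain ⟨q, hq, hqU⟩ := hU.exists_insert_mem_line hcard hv hb' hsub
      exact ⟨{(q, b)}, by simp, by simpa using hqU, fun _ => Or.inl ⟨q, hq, by simp⟩⟩
    · simp only [Done, not_forall] at hdone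
      obtain ⟨hv₁, hv₂, hv⟩ := hdone
      obtain ⟨p, hp⟩ := hU.exists_insert_insert hcard hv₁ hv₂ hv
      have heq : U ∪ {(p + v, b), (p, b)} = insert (p + v, b) (insert (p, b) U) := by
        ext; simp
      refine ⟨{(p + v, b), (p, b)}, by simp, by rwa [heq], fun _ _ => ?_⟩
      have h₁ : p + v ∈ colour (U ∪ {(p + v, b), (p, b)}) b := by simp [colour]
      have h₂ : p ∈ colour (U ∪ {(p + v, b), (p, b)}) b := by simp [colour]
      simpa using Submodule.sub_mem _ (Submodule.subset_span h₁) (Submodule.subset_span h₂)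
  obtain ⟨U, hU, hD⟩ := exists_good_forall_done aleph0_lt_continuum (by simp [mk_real])
    IsPartialMazurkiewicz.empty (fun _ _ h hV => hV.mono h)
    (fun _ h => IsPartialMazurkiewicz.of_finite h) done_mono extend
  exact ⟨U, hU, fun b p v => hD (.inl (b, p, v)), fun b v => hD (.inr (b, v))⟩

theorem IsPartialMazurkiewicz.isMazurkiewicz {U : Set ((ℝ × ℝ) × Bool)}
    (hU : IsPartialMazurkiewicz U)
    (h : ∀ b p v, v ≠ 0 → (∃ q ∈ lineThrough p v, (q, b) ∈ U) ∨
        (v.1 ≠ 0 ∧ v.2 ≠ 0 ∧ ∃ x ∈ U, ∃ y ∈ U, x.1 ∈ lineThrough p v ∧ y.1 ∈ lineThrough p v ∧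
          x.1 ≠ y.1)) :
    IsMazurkiewicz (colour U true ∪ colour U false) := by
  have hmem : ∀ q, q ∈ colour U true ∪ colour U false ↔ ∃ x ∈ U, x.1 = q := by
    intro q
    simp only [colour, mem_union, mem_ofPred_eq, Prod.exists, Bool.exists_bool]
    grind
  rintro L ⟨p, v, hv, rfl⟩
  have htwo : ∃ x ∈ U, ∃ y ∈ U, x.1 ∈ lineThrough p v ∧ y.1 ∈ lineThrough p v ∧ x.1 ≠ y.1 := by
    rcases h true p v hv with ⟨q, hq, hqU⟩ | h₁
    · rcases h false p v hv with ⟨r, hr, hrU⟩ | h₂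
      · refine ⟨_, hqU, _, hrU, hq, hr, fun heq => ?_⟩
        simpa using hU.colour_unique _ hqU _ hrU heq
      · exact h₂.2.2
    · exact h₁.2.2
  obtain ⟨x, hx, y, hy, hxL, hyL, hxy⟩ := htwo
  refine encard_eq_two.2 ⟨x.1, y.1, hxy, Subset.antisymm ?_ ?_⟩
  · rintro q ⟨hq, hqL⟩
    obtain ⟨z, hz, rfl⟩ := (hmem q).1 hq
    by_contra hne
    simp only [mem_insert_iff, mem_singleton_iff, not_or] at hne
    refine hU.not_collinear x hx y hy z hz hxy (Ne.symm hne.1) (Ne.symm hne.2) ?_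
    obtain ⟨a, ha⟩ := hxL
    obtain ⟨b, hb⟩ := hyL
    obtain ⟨c, hc⟩ := hqL
    rw [ha, hb, hc]
    simp only [signedArea, Prod.fst_add, Prod.snd_add, Prod.smul_fst, Prod.smul_snd, smul_eq_mul]
    ring
  · rintro q (rfl | rfl)
    · exact ⟨(hmem _).2 ⟨x, hx, rfl⟩, hxL⟩
    · exact ⟨(hmem _).2 ⟨y, hy, rfl⟩, hyL⟩

/-- `rot θ` as a `ℚ`-linear automorphism of the plane. -/
def rotEquiv (θ : ℝ) : (ℝ × ℝ) ≃ₗ[ℚ] (ℝ × ℝ) where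
  toFun := rot θ
  invFun := rot (-θ)
  map_add' p q := by ext <;> simp [rot] <;> ring
  map_smul' c p := by ext <;> simp [rot, Rat.smul_def] <;> ring
  left_inv p := by
    ext <;> simp only [rot, Real.cos_neg, Real.sin_neg]
    · linear_combination p.1 * Real.sin_sq_add_cos_sq θ
    · linear_combination p.2 * Real.sin_sq_add_cos_sq θ
  right_inv p := by
    ext <;> simp only [rot, Real.cos_neg, Real.sin_neg]
    · linear_combination p.1 * Real.sin_sq_add_cos_sq θ
    · linear_combination p.2 * Real.sin_sq_add_cos_sq θ

theorem IsHamelBasis.image {H : Set (ℝ × ℝ)} (hH : IsHamelBasis H)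
    (e : (ℝ × ℝ) ≃ₗ[ℚ] (ℝ × ℝ)) : IsHamelBasis (e '' H) := by
  refine ⟨?_, ?_⟩
  · have h : LinearIndepOn ℚ id H := hH.1
    exact (h.map_injOn e.toLinearMap e.injective.injOn).id_image
  · have := Submodule.map_span e.toLinearMap H
    rw [hH.2, Submodule.map_top, LinearEquiv.range] at this
    exact this.symm

theorem IsHamelBasis.exists_isHamelFun {H : Set (ℝ × ℝ)} (hH : IsHamelBasis H)
    (hgraph : ∀ x, ∃! q, q ∈ H ∧ q.1 = x) : ∃ f, IsHamelFun f ∧ H = graphOf f := by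
  choose q hq hq' using hgraph
  have heq : H = graphOf fun x => (q x).2 := by
    ext p
    constructor
    · exact fun hp => ⟨p.1, Prod.ext rfl (congrArg Prod.snd (hq' p.1 p ⟨hp, rfl⟩) :)⟩
    · rintro ⟨x, rfl⟩
      have h : (x, (q x).2) = q x := Prod.ext (hq x).2.symm rfl
      rw [h]
      exact (hq x).1
  exact ⟨_, by rw [IsHamelFun, ← heq]; exact hH, heq⟩

theorem span_eq_top_of_forall_mem {S : Submodule ℚ (ℝ × ℝ)}
    (h : ∀ v : ℝ × ℝ, v.1 ≠ 0 → v.2 ≠ 0 → v ∈ S) : S = ⊤ := by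
  have hsplit : ∀ x : ℝ, ∃ a : ℝ, a ≠ 0 ∧ x - a ≠ 0 := by
    intro x
    by_cases hx : x = 1
    · exact ⟨2, by norm_num, by rw [hx]; norm_num⟩
    · exact ⟨1, one_ne_zero, sub_ne_zero.2 hx⟩
  refine eq_top_iff.2 fun v _ => ?_
  obtain ⟨a, ha, ha'⟩ := hsplit v.1
  obtain ⟨c, hc, hc'⟩ := hsplit v.2
  have := S.add_mem (h (a, c) ha hc) (h (v.1 - a, v.2 - c) ha' hc')
  simpa using this

/-- There is a Mazurkiewicz set that is a union of two Hamel functions, and so is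
each of its rotations by `π/2`, `π`, `3π/2` about the origin. -/
theorem stmt_19 :
    ∃ M : Set (ℝ × ℝ), IsMazurkiewicz M ∧
      ∀ θ ∈ ({0, Real.pi / 2, Real.pi, 3 * Real.pi / 2} : Set ℝ),
        ∃ f g : ℝ → ℝ, IsHamelFun f ∧ IsHamelFun g ∧
          rot θ '' M = graphOf f ∪ graphOf g := by
  obtain ⟨U, hU, hline, hspan⟩ := exists_two_coloured_mazurkiewicz
  refine ⟨_, hU.isMazurkiewicz hline, fun θ hθ => ?_⟩
  have hHamel : ∀ b, IsHamelBasis (colour U b) := fun b =>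
    ⟨hU.linearIndepOn b, span_eq_top_of_forall_mem (hspan b)⟩
  have hfst : ∀ b x, ∃! q, q ∈ colour U b ∧ q.1 = x := by
    intro b x
    have hv : ((0, 1) : ℝ × ℝ) ≠ 0 := by simp
    rcases hline b (x, 0) (0, 1) hv with ⟨q, hq, hqU⟩ | h
    · have hqx : q.1 = x := by
        simpa [sub_eq_zero] using (mem_lineThrough_iff hv).1 hq
      exact ⟨q, ⟨hqU, hqx⟩, fun r hr => hU.fst_inj (r, b) hr.1 (q, b) hqU rfl (hr.2.trans hqx.symm)⟩
    · exact absurd rfl h.1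
  have hsnd : ∀ b y, ∃! q, q ∈ colour U b ∧ q.2 = y := by
    intro b y
    have hv : ((1, 0) : ℝ × ℝ) ≠ 0 := by simp
    rcases hline b (0, y) (1, 0) hv with ⟨q, hq, hqU⟩ | h
    · have hqy : q.2 = y := by
        have := (mem_lineThrough_iff hv).1 hq
        simp at this
        linarith
      exact ⟨q, ⟨hqU, hqy⟩, fun r hr => hU.snd_inj (r, b) hr.1 (q, b) hqU rfl (hr.2.trans hqy.symm)⟩
    · exact absurd rfl h.2.1
  have key : ∀ b, ∃ f, IsHamelFun f ∧ rot θ '' colour U b = graphOf f := by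
    intro b
    refine ((hHamel b).image (rotEquiv θ)).exists_isHamelFun fun x => ?_
    have hrot : ∃! q, q ∈ colour U b ∧ (rot θ q).1 = x := by
      have h3 : Real.cos (3 * Real.pi / 2) = 0 ∧ Real.sin (3 * Real.pi / 2) = -1 := by
        rw [show 3 * Real.pi / 2 = Real.pi / 2 + Real.pi by ring]
        simp [Real.cos_add_pi, Real.sin_add_pi]
      rcases hθ with rfl | rfl | rfl | rfl
      · simpa [rot] using hfst b x
      · simpa [rot, neg_eq_iff_eq_neg] using hsnd b (-x)
      · simpa [rot, neg_eq_iff_eq_neg] using hfst b (-x)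
      · simpa [rot, h3] using hsnd b x
    obtain ⟨q, ⟨hq, hqx⟩, huniq⟩ := hrot
    refine ⟨rot θ q, ⟨⟨q, hq, rfl⟩, hqx⟩, ?_⟩
    rintro _ ⟨⟨r, hr, rfl⟩, hrx⟩
    exact congrArg (rot θ) (huniq r ⟨hr, hrx⟩)
  obtain ⟨f, hf, hf'⟩ := key true
  obtain ⟨g, hg, hg'⟩ := key false
  exact ⟨f, g, hf, hg, by rw [image_union, hf', hg']⟩
end
end
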